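/- There is an absolute constant c > 0 with the following property (Generalized Sandwich Lemma). Let P be a set of n distinct points in ℝ^d, let γ ∈ (0,1), δ ∈ (0,1/3), η ∈ (0,1), and let f : ℝ^d → ℝ be injective on P. Let (x_r)_{r≥0} be a family of subsets of ℝ^d satisfying: (i) r ≤ r' implies x_r ⊆ x_{r'}; (ii) for every r ≥ 0, p₀ ∈ x_r, and p ∈ ℝ^d with f(p) ≤ f(p₀), one has p ∈ x_r; and (iii) for every p ∈ ℝ^d there exists a minimal r_p ≥ 0 with p ∈ x_{r_p} and p ∉ x_r for all 0 ≤ r < r_p. Assume t := (1+δ)γn and ((1+δ)²/(1−δ))·γn are integers with t < n and ((1+δ)²/(1−δ))·γn ≤ n; let Q be the set of the t points of P with the largest f-values, and let l ≥ 0 satisfy P ∖ x_l = Q. Let m be an integer with m ≥ c·(1/(δ²γ))·log(1/η) such that k := (1+δ)²γm is an integer with k < m. Let X_1, …, X_m be independent random variables, each uniformly distributed on P, let q be a sampled point attaining the (k+1)-th largest value among f(X_1), …, f(X_m), and set l̃ := min{r ≥ 0 : q ∈ x_r}. Then, with probability at least 1−η, both l̃ ≤ l and |P ∖ x_{l̃}|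 ≤ ((1+δ)²/(1−δ))·γn hold. -/

import Mathlib

open MeasureTheory

/-- Expectation of `h` under the binomial law. -/
noncomputable def bE (p : ℝ) : ℕ → (ℕ → ℝ) → ℝ
  | 0, h => h 0
  | m + 1, h => (1 - p) * bE p m h + p * bE p m (fun j => h (j + 1))

lemma bE_add (p : ℝ) (m : ℕ) : ∀ g h : ℕ → ℝ,
    bE p m (fun j => g j + h j) = bE p m g + bE p m h := by
  induction m with
  | zero => intro g h; rfl
  | succ m ih => intro g h; simp only [bE, ih]; ring

lemma bE_smul (p : ℝ) (m : ℕ) (a : ℝ) : ∀ h : ℕ → ℝ,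
    bE p m (fun j => a * h j) = a * bE p m h := by
  induction m with
  | zero => intro h; rfl
  | succ m ih => intro h; simp only [bE, ih]; ring

lemma bE_sub (p : ℝ) (m : ℕ) : ∀ g h : ℕ → ℝ,
    bE p m (fun j => g j - h j) = bE p m g - bE p m h := by
  induction m with
  | zero => intro g h; rfl
  | succ m ih => intro g h; simp only [bE, ih]; ring

lemma bE_const (p : ℝ) (m : ℕ) (a : ℝ) : bE p m (fun _ => a) = a := by
  induction m with
  | zero => rfl
  | succ m ih => simp only [bE, ih]; ring

lemma bE_mono {p : ℝ} (h0 : 0 ≤ p) (h1 : p ≤ 1) (m : ℕ) : ∀ g h : ℕ → ℝ,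
    (∀ j, g j ≤ h j) → bE p m g ≤ bE p m h := by
  induction m with
  | zero => intro g h H; exact H 0
  | succ m ih =>
    intro g h H
    simp only [bE]
    have a := ih _ _ H
    have b := ih _ _ (fun j => H (j + 1))
    have : 0 ≤ 1 - p := by linarith
    gcongr

lemma bE_exp (p s : ℝ) (m : ℕ) :
    bE p m (fun j => Real.exp (s * j)) = (1 - p + p * Real.exp s) ^ m := by
  induction m with
  | zero => simp [bE]
  | succ m ih =>
    have : (fun j : ℕ => Real.exp (s * ((j + 1 : ℕ) : ℝ)))
        = fun j : ℕ => Real.exp s * Real.exp (s * j) := by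
      funext j; rw [← Real.exp_add]; congr 1; push_cast; ring
    simp only [bE]
    rw [this, bE_smul, ih]; ring

lemma bE_hasDerivAt (m : ℕ) : ∀ (h : ℕ → ℝ) (p : ℝ),
    HasDerivAt (fun p => bE p (m + 1) h)
      ((m + 1) * bE p m (fun j => h (j + 1) - h j)) p := by
  induction m with
  | zero =>
    intro h p
    change HasDerivAt (fun p : ℝ => (1 - p) * h 0 + p * h (0 + 1))
      (((0 : ℕ) + 1) * (h (0 + 1) - h 0)) p
    have a : HasDerivAt (fun p : ℝ => (1 - p) * h 0 + p * h (0 + 1))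
      ((0 - 1) * h 0 + 1 * h (0 + 1)) p :=
      (((hasDerivAt_const p 1).sub (hasDerivAt_id p)).mul_const _).add
        ((hasDerivAt_id p).mul_const _)
    convert a using 1
    push_cast; ring
  | succ m ih =>
    intro h p
    have a : HasDerivAt (fun p => bE p (m + 1 + 1) h) _ p :=
      (((hasDerivAt_const p (1:ℝ)).sub (hasDerivAt_id p)).mul (ih h p)).add
        ((hasDerivAt_id p).mul (ih (fun j => h (j + 1)) p))
    refine a.congr_deriv ?_
    have e1 : bE p (m + 1) (fun j => h (j + 1) - h j) =
        (1 - p) * bE p m (fun j => h (j + 1) - h j)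
          + p * bE p m (fun j => h (j + 1 + 1) - h (j + 1)) := rfl
    have e2 := bE_sub p (m + 1) (fun j => h (j + 1)) h
    push_cast
    simp only [Pi.sub_apply, id]
    linear_combination (-(m : ℝ) - 1) * e1 - e2

/-- centered moments -/
lemma bE_shift (p : ℝ) (m : ℕ) :
    bE p m (fun j => (j : ℝ)  - m * p) = 0 ∧
    bE p m (fun j => ((j : ℝ)  - m * p) ^ 2) = m * (p * (1 - p)) ∧
    ∃ c3, bE p m (fun j => ((j : ℝ)  - m * p) ^ 3) = c3 ∧
    bE p m (fun j => ((j : ℝ)  - m * p) ^ 4) =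
      3 * (m * (p * (1 - p))) ^ 2 + m * (p * (1 - p)) * (1 - 6 * (p * (1 - p))) := by
  induction m with
  | zero => simp [bE]
  | succ m ih =>
    obtain ⟨h1, h2, c3, h3, h4⟩ := ih
    have key : ∀ a : ℝ, 
       bE p m (fun j => ((j : ℝ) - m * p) + a) = a ∧
       bE p m (fun j => (((j : ℝ) - m * p) + a) ^ 2) = m * (p * (1 - p)) + a ^ 2 ∧
       bE p m (fun j => (((j : ℝ) - m * p) + a) ^ 4) =
        (3 * (m * (p * (1 - p))) ^ 2 + m * (p * (1 - p)) * (1 - 6 * (p * (1 - p))))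
         + 4 * a * c3 + 6 * a ^ 2 * (m * (p * (1 - p))) + a ^ 4 := by
      intro a
      refine ⟨?_, ?_, ?_⟩
      · rw [bE_add, bE_const, h1]; ring
      · have : (fun j : ℕ => (((j : ℝ) - m * p) + a) ^ 2) = fun j : ℕ =>
          ((j : ℝ) - m * p) ^ 2 + ((2 * a) * ((j : ℝ) - m * p) + a ^ 2) := by
          funext j; ring
        rw [this, bE_add, bE_add, bE_smul, bE_const, h1, h2]; ring
      · have : (fun j : ℕ => (((j : ℝ) - m * p) + a) ^ 4) = fun j : ℕ =>
          ((j : ℝ) - m * p) ^ 4 + ((4 * a) * ((j : ℝ) - m * p) ^ 3 +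
           ((6 * a ^ 2) * ((j : ℝ) - m * p) ^ 2 + ((4 * a ^ 3) * ((j : ℝ) - m * p) + a ^ 4))) := by
          funext j; ring
        rw [this, bE_add, bE_add, bE_add, bE_add, bE_smul, bE_smul, bE_smul, bE_const,
          h1, h2, h3, h4]; ring
    have e1 : ∀ r : ℕ, (fun j : ℕ => ((j : ℝ) - ((m + 1 : ℕ) : ℝ) * p) ^ r) =
        fun j : ℕ => (((j : ℝ) - m * p) + (-p)) ^ r := by
      intro r; funext j; push_cast; congr 1; ring
    have e2 : ∀ r : ℕ, (fun j : ℕ => (((j + 1 : ℕ) : ℝ) - ((m + 1 : ℕ) : ℝ) * p) ^ r) =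
        fun j : ℕ => (((j : ℝ) - m * p) + (1 - p)) ^ r := by
      intro r; funext j; push_cast; congr 1; ring
    obtain ⟨a1, a2, a4⟩ := key (-p)
    obtain ⟨b1, b2, b4⟩ := key (1 - p)
    refine ⟨?_, ?_, _, rfl, ?_⟩
    · have x1 := e1 1
      have x2 := e2 1
      simp only [pow_one] at x1 x2
      simp only [bE]
      rw [x1, x2, a1, b1]; ring
    · simp only [bE]
      rw [e1, e2, a2, b2]; push_cast; ring
    · simp only [bE]
      rw [e1, e2, a4, b4]; push_cast; ring

lemma bE_single (p : ℝ) (m : ℕ) : ∀ k : ℕ,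
    bE p m (fun j => if j = k then 1 else 0) = (m.choose k) * (p ^ k * (1 - p) ^ (m - k)) := by
  induction m with
  | zero => intro k; cases k <;> simp [bE]
  | succ m ih =>
    intro k
    cases k with
    | zero =>
      have : bE p m (fun j => if j + 1 = 0 then 1 else 0) = 0 := by
        simpa using bE_const p m 0
      simp only [bE]
      rw [this, ih]; simp [pow_succ]; ring
    | succ k =>
      simp only [bE, add_left_inj]
      rw [ih, ih, Nat.choose_succ_succ]
      rcases Nat.lt_or_ge m (k + 1) with h | h
      · rw [Nat.choose_eq_zero_of_lt h]
        push_cast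
        ring
      · obtain ⟨a, rfl⟩ := Nat.exists_eq_add_of_le h
        have x1 : k + 1 + a - (k + 1) = a := by omega
        have x2 : k + 1 + a - k = a + 1 := by omega
        have x3 : k + 1 + a + 1 - (k + 1) = a + 1 := by omega
        rw [x1, x2, x3]
        push_cast; ring

/-- upper tail -/
noncomputable def bG (m k : ℕ) (p : ℝ) : ℝ := bE p m (fun j => if k < j then 1 else 0)

lemma bG_hasDerivAt (m k : ℕ) (p : ℝ) :
    HasDerivAt (bG (m + 1) k) ((m + 1) * ((m.choose k) * (p ^ k * (1 - p) ^ (m - k)))) p := by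
  have := bE_hasDerivAt m (fun j => if k < j then 1 else 0) p
  have e : (fun j : ℕ => (if k < j + 1 then (1:ℝ) else 0) - if k < j then 1 else 0) =
      fun j => if j = k then 1 else 0 := by
    funext j; split_ifs <;> first | omega | norm_num
  rw [e, bE_single] at this
  exact this

lemma beta_mono {k a : ℕ} {u v : ℝ} (hu : 0 ≤ u) (huv : u ≤ v) (hv : v < 1)
    (h : (k + a : ℝ) * v ≤ k) : u ^ k * (1 - u) ^ a ≤ v ^ k * (1 - v) ^ a := by
  rcases hu.eq_or_lt with rfl | hu
  · rcases Nat.eq_zero_or_pos k with rfl | hk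
    · rcases Nat.eq_zero_or_pos a with rfl | ha
      · simp
      · have : (0:ℝ) < a := by exact_mod_cast ha
        have : v = 0 := by push_cast at h; nlinarith
        subst this; simp
    · rw [zero_pow hk.ne', zero_mul]
      have : 0 ≤ 1 - v := by linarith
      positivity
  have hv0 : 0 < v := by linarith
  have h1v : 0 < 1 - v := by linarith
  have A : u ≤ v * Real.exp (u / v - 1) := by
    have := Real.add_one_le_exp (u / v - 1)
    calc u = v * (u / v - 1 + 1) := by field_simp; ring
      _ ≤ _ := by gcongr
  have B : 1 - u ≤ (1 - v) * Real.exp ((1 - u) / (1 - v) - 1) := by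
    have := Real.add_one_le_exp ((1 - u) / (1 - v) - 1)
    calc 1 - u = (1 - v) * ((1 - u) / (1 - v) - 1 + 1) := by field_simp; ring
      _ ≤ _ := by gcongr
  have h1u : 0 ≤ 1 - u := by linarith
  calc u ^ k * (1 - u) ^ a ≤ (v * Real.exp (u / v - 1)) ^ k *
        ((1 - v) * Real.exp ((1 - u) / (1 - v) - 1)) ^ a := by gcongr
    _ = v ^ k * (1 - v) ^ a * Real.exp (k * (u / v - 1) + a * ((1 - u) / (1 - v) - 1)) := by
        rw [mul_pow, mul_pow, Real.exp_add, Real.exp_nat_mul, Real.exp_nat_mul]; ring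
    _ ≤ v ^ k * (1 - v) ^ a * 1 := by
        gcongr
        rw [Real.exp_le_one_iff]
        have : k * (u / v - 1) + a * ((1 - u) / (1 - v) - 1)
          = (v - u) * ((k + a) * v - k) / (v * (1 - v)) := by field_simp; ring
        rw [this]
        apply div_nonpos_of_nonpos_of_nonneg
        · apply mul_nonpos_of_nonneg_of_nonpos <;> linarith
        · positivity
    _ = _ := mul_one _

lemma bG_convex (m k : ℕ) (hk : k ≤ m) :
    ConvexOn ℝ (Set.Icc 0 ((k : ℝ) / (m + 1))) (bG (m + 1) k) := by
  apply MonotoneOn.convexOn_of_deriv (convex_Icc _ _)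
  · exact fun p _ => (bG_hasDerivAt m k p).continuousAt.continuousWithinAt
  · exact fun p _ => (bG_hasDerivAt m k p).differentiableAt.differentiableWithinAt
  · rw [interior_Icc]
    intro u hu v hv huv
    rw [(bG_hasDerivAt m k u).deriv, (bG_hasDerivAt m k v).deriv]
    have hm : (0:ℝ) < m + 1 := by positivity
    have hkm : (k : ℝ) ≤ m := by exact_mod_cast hk
    have hv2 := (lt_div_iff₀ hm).1 hv.2
    have : u ^ k * (1 - u) ^ (m - k) ≤ v ^ k * (1 - v) ^ (m - k) := by
      apply beta_mono hu.1.le huv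
      · have := hv.1; nlinarith
      · rw [Nat.cast_sub hk]; have := hv.1; nlinarith
    gcongr

lemma bG_mono (m k : ℕ) : MonotoneOn (bG (m + 1) k) (Set.Icc 0 1) := by
  apply monotoneOn_of_deriv_nonneg (convex_Icc _ _)
  · exact fun p _ => (bG_hasDerivAt m k p).continuousAt.continuousWithinAt
  · exact fun p _ => (bG_hasDerivAt m k p).differentiableAt.differentiableWithinAt
  · rw [interior_Icc]
    intro u hu
    rw [(bG_hasDerivAt m k u).deriv]
    have := hu.1
    have : 0 ≤ 1 - u := by linarith [hu.2]
    positivity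

/-- Paley–Zygmund -/
lemma bG_mean (m k : ℕ) (hk : 1 ≤ k) (hkm : k < m) : 1 / 12 ≤ bG m k ((k : ℝ) / m) := by
  have hk' : (1:ℝ) ≤ k := by exact_mod_cast hk
  have hkm' : (k:ℝ) + 1 ≤ m := by exact_mod_cast hkm
  have hm : (0:ℝ) < m := by linarith
  set p : ℝ := (k : ℝ) / m with hp
  have hmp : m * p = k := by rw [hp]; field_simp
  have hp0 : 0 ≤ p := by positivity
  have hp1 : p ≤ 1 := by rw [hp, div_le_one hm]; linarith
  obtain ⟨h1, h2, c3, h3, h4⟩ := bE_shift p m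
  rw [hmp] at h1 h2 h4
  set v : ℝ := m * (p * (1 - p)) with hv
  have hv2 : 1 / 2 ≤ v := by
    have : v = k * (m - k) / m := by rw [hv, hp]; field_simp
    rw [this, le_div_iff₀ hm]
    nlinarith
  have hv0 : 0 < v := by linarith
  set s := Real.sqrt v with hs
  have hs0 : 0 < s := Real.sqrt_pos.2 hv0
  have hs2 : s ^ 2 = v := Real.sq_sqrt hv0.le
  have h4' : bE p m (fun j => ((j : ℝ) - k) ^ 4) ≤ 5 * v ^ 2 := by
    rw [h4]
    have : 0 ≤ p * (1 - p) := mul_nonneg hp0 (by linarith)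
    nlinarith
  have key := bE_mono hp0 hp1 m (fun j => (16 / (84 * s)) * ((j : ℝ) - k) +
    ((12 / (84 * v)) * ((j : ℝ) - k) ^ 2 - (1 / (84 * v ^ 2)) * ((j : ℝ) - k) ^ 4))
    (fun j => if k < j then 1 else 0) (by
      intro j
      have e : (16 / (84 * s)) * ((j : ℝ) - k) +
        ((12 / (84 * v)) * ((j : ℝ) - k) ^ 2 - (1 / (84 * v ^ 2)) * ((j : ℝ) - k) ^ 4)
        = (16 * (((j : ℝ) - k) / s) + 12 * (((j : ℝ) - k) / s) ^ 2
          - (((j : ℝ) - k) / s) ^ 4) / 84 := by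
        rw [← hs2]; field_simp; ring
      rw [e]
      set z := ((j : ℝ) - k) / s with hz
      split_ifs with hjk
      · nlinarith [sq_nonneg (z ^ 2 - 7.5), sq_nonneg (z - 8/3)]
      · have : z ≤ 0 := by
          apply div_nonpos_of_nonpos_of_nonneg _ hs0.le
          have : (j:ℝ) ≤ k := by exact_mod_cast not_lt.1 hjk
          linarith
        have e2 : 16 * z + 12 * z ^ 2 - z ^ 4 = z * ((z + 2) ^ 2 * (4 - z)) := by ring
        rw [e2]
        apply div_nonpos_of_nonpos_of_nonneg _ (by norm_num)
        apply mul_nonpos_of_nonpos_of_nonneg this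
        have : 0 ≤ 4 - z := by linarith
        positivity)
  rw [bE_add, bE_sub, bE_smul, bE_smul, bE_smul, h1, h2] at key
  have : (1 / (84 * v ^ 2)) * bE p m (fun j => ((j : ℝ) - k) ^ 4) ≤
    (1 / (84 * v ^ 2)) * (5 * v ^ 2) := by gcongr
  have e3 : (1 / (84 * v ^ 2)) * (5 * v ^ 2) = 5 / 84 := by field_simp
  have e4 : (12 / (84 * v)) * v = 12 / 84 := by field_simp
  rw [e4] at key
  unfold bG
  linarith

lemma bG_cheb (m k : ℕ) (hk : 1 ≤ k) {p δ : ℝ} (hp0 : 0 ≤ p) (hp1 : p ≤ 1) (hδ : 0 < δ)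
    (h : m * p = k / (1 + δ)) : bG m k p ≤ (1 + δ) / (δ ^ 2 * k) := by
  have hk' : (1:ℝ) ≤ k := by exact_mod_cast hk
  obtain ⟨-, h2, -⟩ := bE_shift p m
  have hd : (k:ℝ) - m * p = δ * k / (1 + δ) := by rw [h]; field_simp; ring
  have hd0 : 0 < δ * k / (1 + δ) := by positivity
  set D := δ * k / (1 + δ) with hD
  have key := bE_mono hp0 hp1 m (fun j => if k < j then 1 else 0)
    (fun j => (1 / D ^ 2) * ((j : ℝ) - m * p) ^ 2) (by
      intro j
      split_ifs with hj
      · have : (k:ℝ) < j := by exact_mod_cast hj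
        rw [one_div, inv_mul_eq_div, one_le_div (by positivity)]
        gcongr
        linarith
      · positivity)
  rw [bE_smul, h2] at key
  refine key.trans ?_
  calc 1 / D ^ 2 * (m * (p * (1 - p))) ≤ 1 / D ^ 2 * (k / (1 + δ)) := by
        gcongr
        rw [← h]
        have : 0 ≤ (m:ℝ) * p := by positivity
        nlinarith
    _ = _ := by rw [hD]; field_simp

lemma exp_le_quad {s : ℝ} (h : |s| ≤ 1) : Real.exp s ≤ 1 + s + s ^ 2 := by
  have := Real.abs_exp_sub_one_sub_id_le h
  have := (abs_le.1 this).2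
  linarith

lemma bE_exp_le {p : ℝ} (hp0 : 0 ≤ p) (hp1 : p ≤ 1) (s : ℝ) (m : ℕ) :
    bE p m (fun j => Real.exp (s * j)) ≤ Real.exp (m * p * (Real.exp s - 1)) := by
  rw [bE_exp]
  have h := Real.add_one_le_exp (p * (Real.exp s - 1))
  have : 0 ≤ 1 - p + p * Real.exp s := by
    have : 0 ≤ 1 - p := by linarith
    positivity
  calc _ ≤ (Real.exp (p * (Real.exp s - 1))) ^ m := by
        gcongr; linarith
    _ = _ := by rw [← Real.exp_nat_mul]; congr 1; ring

lemma chern_upper (m k : ℕ) {p δ : ℝ} (hp0 : 0 ≤ p) (hp1 : p ≤ 1) (hδ : 0 < δ)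
    (hδ' : δ < 1 / 3) (h : m * p = k / (1 + δ)) :
    bG m k p ≤ Real.exp (-(3 / 16) * (δ ^ 2 * k)) := by
  have key := bE_mono hp0 hp1 m (fun j => if k < j then 1 else 0)
    (fun j => Real.exp (-(δ / 2) * k) * Real.exp (δ / 2 * j)) (by
      intro j
      split_ifs with hj
      · have : (k:ℝ) < j := by exact_mod_cast hj
        rw [← Real.exp_add]
        apply Real.one_le_exp
        nlinarith
      · positivity)
  rw [bE_smul] at key
  refine key.trans ((mul_le_mul_of_nonneg_left (bE_exp_le hp0 hp1 _ m) (by positivity)).trans ?_)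
  rw [← Real.exp_add, Real.exp_le_exp, h]
  have hq := exp_le_quad (s := δ / 2) (by rw [abs_of_pos] <;> linarith)
  have hk : (0:ℝ) ≤ k := by positivity
  calc -(δ / 2) * k + k / (1 + δ) * (Real.exp (δ / 2) - 1)
      ≤ -(δ / 2) * k + k / (1 + δ) * (δ / 2 + (δ / 2) ^ 2) := by
        gcongr; linarith
    _ = -(1 / (4 * (1 + δ))) * (δ ^ 2 * k) := by field_simp; ring
    _ ≤ _ := by
        apply mul_le_mul_of_nonneg_right _ (by positivity)
        rw [neg_le_neg_iff, div_le_div_iff₀ (by norm_num) (by positivity)]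
        linarith

lemma chern_lower (m k : ℕ) {p δ : ℝ} (hp0 : 0 ≤ p) (hp1 : p ≤ 1) (hδ : 0 < δ)
    (hδ' : δ < 1 / 3) (h : m * p = k / (1 - δ)) :
    1 - bG m k p ≤ Real.exp (-(3 / 16) * (δ ^ 2 * k)) := by
  have key := bE_mono hp0 hp1 m (fun j => 1 - if k < j then 1 else 0)
    (fun j => Real.exp (δ / 2 * k) * Real.exp (-(δ / 2) * j)) (by
      intro j
      split_ifs with hj
      · simp; positivity
      · have : (j:ℝ) ≤ k := by exact_mod_cast not_lt.1 hj
        rw [← Real.exp_add, sub_zero]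
        apply Real.one_le_exp
        nlinarith)
  rw [bE_smul, bE_sub, bE_const] at key
  refine key.trans ((mul_le_mul_of_nonneg_left (bE_exp_le hp0 hp1 _ m) (by positivity)).trans ?_)
  rw [← Real.exp_add, Real.exp_le_exp, h]
  have hq := exp_le_quad (s := -(δ / 2)) (by rw [abs_neg, abs_of_pos] <;> linarith)
  have hk : (0:ℝ) ≤ k := by positivity
  have h1 : 0 < 1 - δ := by linarith
  calc (δ / 2) * k + k / (1 - δ) * (Real.exp (-(δ / 2)) - 1)
      ≤ (δ / 2) * k + k / (1 - δ) * (-(δ / 2) + (δ / 2) ^ 2) := by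
        gcongr; linarith
    _ = -(1 / (4 * (1 - δ))) * (δ ^ 2 * k) := by field_simp; ring
    _ ≤ _ := by
        apply mul_le_mul_of_nonneg_right _ (by positivity)
        rw [neg_le_neg_iff, div_le_div_iff₀ (by norm_num) (by positivity)]
        linarith

set_option maxHeartbeats 1000000 in
/-- main analytic estimate -/
lemma bG_window (m k : ℕ) (hk : 1 ≤ k) (hkm : k < m) {p p2 δ η : ℝ} (hp0 : 0 ≤ p)
    (hp2 : p2 ≤ 1) (hδ : 0 < δ) (hδ' : δ < 1 / 3) (h : m * p = k / (1 + δ))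
    (h2 : m * p2 = k / (1 - δ)) (hη : 0 < η)
    (hlog : 10000 * Real.log (1 / η) ≤ δ ^ 2 * k) : 1 - η ≤ bG m k p2 - bG m k p := by
  have hk' : (1:ℝ) ≤ k := by exact_mod_cast hk
  have hkm' : (k:ℝ) + 1 ≤ m := by exact_mod_cast hkm
  have hm : (0:ℝ) < m := by linarith
  have h1δ : 0 < 1 - δ := by linarith
  set b : ℝ := (k:ℝ) / m with hb
  have hmb : m * b = k := by rw [hb]; field_simp
  have hb0 : 0 < b := by positivity
  have hpb' : p = b / (1 + δ) := by
    rw [hb]; field_simp; field_simp at h; linarith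
  have hpb : p ≤ b := by rw [hpb']; apply div_le_self hb0.le; linarith
  have hp2b' : p2 = b / (1 - δ) := by
    rw [hb]; field_simp; field_simp at h2; linarith
  have hp2b : b ≤ p2 := by
    rw [hp2b', le_div_iff₀ h1δ]; nlinarith
  have hlη : Real.log (1 / η) = - Real.log η := by rw [one_div, Real.log_inv]
  rw [hlη] at hlog
  rcases le_or_gt 16 (δ ^ 2 * k) with hD | hD
  · have a1 := chern_upper m k hp0 (by linarith) hδ hδ' h
    have a2 := chern_lower m k (by linarith) hp2 hδ hδ' h2
    have : 2 * Real.exp (-(3 / 16) * (δ ^ 2 * k)) ≤ η := by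
      have e1 : (2:ℝ) ≤ Real.exp 1 := by have := Real.add_one_le_exp (1:ℝ); linarith
      calc 2 * Real.exp (-(3 / 16) * (δ ^ 2 * k)) ≤ Real.exp 1 * Real.exp (-(3 / 16) * (δ ^ 2 * k)) := by
            gcongr
        _ = Real.exp (1 + -(3 / 16) * (δ ^ 2 * k)) := by rw [Real.exp_add]
        _ ≤ Real.exp (Real.log η) := by
            rw [Real.exp_le_exp]; linarith
        _ = η := Real.exp_log hη
    linarith
  · have hη1 : 1 - η ≤ δ ^ 2 * k / 10000 := by
      have := Real.log_le_sub_one_of_pos hη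
      have h3 := Real.log_le_sub_one_of_pos (inv_pos.2 hη)
      have h4 := Real.add_one_le_exp (Real.log η)
      rw [Real.exp_log hη] at h4
      linarith
    obtain ⟨m, rfl⟩ : ∃ m', m = m' + 1 := ⟨m - 1, by omega⟩
    have hmono := bG_mono m k
    have hb1 : b ≤ 1 := hp2b.trans hp2
    have g1 : bG (m + 1) k b ≤ bG (m + 1) k p2 :=
      hmono ⟨hb0.le, hb1⟩ ⟨by linarith, hp2⟩ hp2b
    have g2 : 1 / 12 ≤ bG (m + 1) k b := bG_mean (m + 1) k hk hkm
    set w := Real.sqrt k with hw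
    have hw1 : 1 ≤ w := by rw [hw]; exact Real.one_le_sqrt.2 hk'
    have hw2 : w ^ 2 = k := Real.sq_sqrt (by linarith)
    set δ0 : ℝ := 41 / w with hδ0
    have hδ00 : 0 < δ0 := by positivity
    set a : ℝ := b / (1 + δ0) with ha
    have hab : a < b := by rw [ha]; apply div_lt_self hb0; linarith
    have ha0 : 0 < a := by positivity
    have g3 : bG (m + 1) k a ≤ 1 / 40 := by
      refine (bG_cheb (m + 1) k hk ha0.le (by linarith) hδ00
        (by rw [ha, ← mul_div_assoc, hmb])).trans ?_
      have : δ0 ^ 2 * k = 1681 := by rw [hδ0, ← hw2]; field_simp; norm_num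
      rw [this]
      have : δ0 ≤ 41 := by rw [hδ0]; exact div_le_self (by norm_num) hw1
      linarith
    have g4 : 1 / 40 ≤ bG (m + 1) k b - bG (m + 1) k a := by linarith
    suffices δ ^ 2 * k / 10000 ≤ bG (m + 1) k b - bG (m + 1) k p by linarith
    rcases le_or_gt p a with hpa | hpa
    · have : bG (m + 1) k p ≤ bG (m + 1) k a :=
        hmono ⟨hp0, by linarith⟩ ⟨ha0.le, by linarith⟩ hpa
      linarith
    · have cv := bG_convex m k (by omega)
      have hbm : (k:ℝ) / (m + 1) = b := by rw [hb]; push_cast; rfl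
      rw [hbm] at cv
      have sl := cv.secant_mono (a := b) (x := a) (y := p) ⟨hb0.le, le_rfl⟩ ⟨ha0.le, hab.le⟩
        ⟨hp0, hpb⟩ hab.ne (by
          rw [hpb']; apply ne_of_lt; apply div_lt_self hb0; linarith) hpa.le
      have hpb2 : p < b := by rw [hpb']; apply div_lt_self hb0; linarith
      rw [← neg_div_neg_eq, ← neg_div_neg_eq (_ - _) (p - b), neg_sub, neg_sub, neg_sub, neg_sub,
        div_le_div_iff₀ (by linarith) (by linarith)] at sl
      have s1 : (b - p) * (1 / 40) ≤ (bG (m + 1) k b - bG (m + 1) k p) * (b - a) := by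
        refine le_trans ?_ (le_trans (le_of_eq (mul_comm _ _)) sl)
        exact mul_le_mul_of_nonneg_left g4 (by linarith)
      have s2 : b - p = b * (δ / (1 + δ)) := by rw [hpb']; field_simp; ring
      have s3 : b - a ≤ b * (41 / w) := by
        have : b - a = b * (δ0 / (1 + δ0)) := by rw [ha]; field_simp; ring
        rw [this, ← hδ0]
        exact mul_le_mul_of_nonneg_left (div_le_self hδ00.le (by linarith)) hb0.le
      have s4 : 3 / 4 * δ ≤ δ / (1 + δ) := by
        rw [le_div_iff₀ (by linarith)]; nlinarith
      have hΔ : 0 ≤ bG (m + 1) k b - bG (m + 1) k p :=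
        sub_nonneg.2 (hmono ⟨hp0, by linarith⟩ ⟨hb0.le, hb1⟩ hpb)
      generalize bG (m + 1) k b - bG (m + 1) k p = Δ at *
      have s5 : b * (3 / 4 * δ) * (1 / 40) ≤ Δ * (b * (41 / w)) := by
        have t1 : b * (3 / 4 * δ) ≤ b * (δ / (1 + δ)) := mul_le_mul_of_nonneg_left s4 hb0.le
        have t2 := mul_le_mul_of_nonneg_left s3 hΔ
        linarith
      have s6 : 3 / 160 * (δ * w) ≤ 41 * Δ := by
        have e : Δ * (b * (41 / w)) = b * (41 * Δ / w) := by ring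
        have e2 : b * (3 / 4 * δ) * (1 / 40) = b * (3 / 160 * δ) := by ring
        rw [e, e2] at s5
        have := le_of_mul_le_mul_left s5 hb0
        rw [le_div_iff₀ (by linarith)] at this
        linarith
      have s7 : δ ^ 2 * k = (δ * w) ^ 2 := by rw [← hw2]; ring
      rw [s7] at hD ⊢
      have s8 : 0 < δ * w := by positivity
      have : δ * w ≤ 4 := by nlinarith
      nlinarith

lemma bE_powerset {ι : Type*} [DecidableEq ι] (p : ℝ) (s : Finset ι) : ∀ h : ℕ → ℝ,
    ∑ S ∈ s.powerset, p ^ S.card * (1 - p) ^ (s.card - S.card) * h S.card = bE p s.card h := by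
  induction s using Finset.induction_on with
  | empty => intro h; simp [bE]
  | insert a s ha ih =>
    intro h
    rw [Finset.sum_powerset_insert ha, Finset.card_insert_of_notMem ha]
    simp only [bE]
    rw [← ih, ← ih, Finset.mul_sum, Finset.mul_sum]
    congr 1
    · apply Finset.sum_congr rfl
      intro S hS
      have := Finset.card_le_card (Finset.mem_powerset.1 hS)
      rw [Nat.succ_sub this, pow_succ]; ring
    · apply Finset.sum_congr rfl
      intro S hS
      have : a ∉ S := fun h => ha (Finset.mem_powerset.1 hS h)
      rw [Finset.card_insert_of_notMem this, Nat.succ_sub_succ, pow_succ]; ring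

lemma count_ms {α : Type*} [MeasurableSpace α] (m k : ℕ) (A : Set α) (hA : MeasurableSet A) :
    MeasurableSet {X : Fin m → α | k < ({j : Fin m | X j ∈ A}).ncard} ∧
    ∀ (μ : Measure α) [IsProbabilityMeasure μ] (p : ℝ), μ.real A = p →
      (Measure.pi (fun _ : Fin m => μ)).real {X : Fin m → α | k < ({j : Fin m | X j ∈ A}).ncard}
        = bG m k p := by
  classical
  set B : Finset (Fin m) → Set (Fin m → α) :=
    fun S => Set.pi Set.univ (fun j => if j ∈ S then A else Aᶜ) with hB
  have hmem : ∀ S X, X ∈ B S ↔ S = Finset.univ.filter (fun j => X j ∈ A) := by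
    intro S X
    simp only [hB, Set.mem_pi, Set.mem_univ, true_imp_iff, Finset.ext_iff, Finset.mem_filter,
      Finset.mem_univ, true_and]
    apply forall_congr'
    intro j
    split_ifs with h <;> simp [h]
  have hBm : ∀ S, MeasurableSet (B S) := by
    intro S
    apply MeasurableSet.univ_pi
    intro j
    split_ifs
    · exact hA
    · exact hA.compl
  have hset : {X : Fin m → α | k < ({j : Fin m | X j ∈ A}).ncard} =
      ⋃ S ∈ (Finset.univ.filter (fun S : Finset (Fin m) => k < S.card)), B S := by
    ext X
    simp only [Set.mem_ofPred_eq, Set.mem_iUnion, hmem, Finset.mem_filter, Finset.mem_univ,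
      true_and, exists_prop, exists_eq_right]
    have : {j : Fin m | X j ∈ A} = ((Finset.univ.filter (fun j => X j ∈ A) : Finset (Fin m)) : Set (Fin m)) := by
      ext; simp
    rw [this, Set.ncard_coe_finset]
  refine ⟨?_, ?_⟩
  · rw [hset]
    exact Finset.measurableSet_biUnion _ (fun S _ => hBm S)
  · intro μ _ p hp
    rw [hset, measureReal_biUnion_finset]
    · have hBp : ∀ S, (Measure.pi (fun _ : Fin m => μ)).real (B S) =
          p ^ S.card * (1 - p) ^ (m - S.card) := by
        intro S
        rw [Measure.real, hB, Measure.pi_pi, ENNReal.toReal_prod]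
        have : ∀ j, (μ (if j ∈ S then A else Aᶜ)).toReal = if j ∈ S then p else 1 - p := by
          intro j
          split_ifs
          · exact hp
          · rw [← hp]; exact probReal_compl_eq_one_sub hA
        simp only [this]
        rw [Finset.prod_ite, Finset.prod_const, Finset.prod_const]
        congr 2
        · simp
        · rw [Finset.filter_not, Finset.card_sdiff_of_subset (Finset.filter_subset _ _)]; simp
      simp only [hBp]
      unfold bG
      have := bE_powerset p (Finset.univ : Finset (Fin m)) (fun j => if k < j then 1 else 0)
      rw [Finset.card_univ, Fintype.card_fin] at this
      rw [← this, Finset.powerset_univ, Finset.sum_filter]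
      apply Finset.sum_congr rfl
      intro S _
      split_ifs <;> simp
    · intro S _ T _ hST
      rw [Function.onFun, Set.disjoint_left]
      intro X h1 h2
      exact hST (((hmem _ _).1 h1).trans ((hmem _ _).1 h2).symm)
    · exact fun S _ => hBm S

lemma exists_top {α : Type*} (P : Finset α) (f : α → ℝ) : ∀ t : ℕ, t ≤ P.card →
    ∃ T ⊆ P, T.card = t ∧ ∀ p ∈ T, ∀ q ∈ P, q ∉ T → f q ≤ f p := by
  classical
  intro t
  induction t with
  | zero => intro _; exact ⟨∅, by simp, by simp, by simp⟩
  | succ t ih =>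
    intro ht
    obtain ⟨T, hT, hc, h⟩ := ih (by omega)
    have hne : (P \ T).Nonempty := by
      rw [← Finset.card_pos, Finset.card_sdiff_of_subset hT]; omega
    obtain ⟨a, ha, hmax⟩ := Finset.exists_max_image (P \ T) f hne
    rw [Finset.mem_sdiff] at ha
    refine ⟨insert a T, ?_, ?_, ?_⟩
    · exact Finset.insert_subset ha.1 hT
    · rw [Finset.card_insert_of_notMem ha.2, hc]
    · intro p hp q hq hqT
      rw [Finset.mem_insert, not_or] at hqT
      rcases Finset.mem_insert.1 hp with rfl | hp
      · exact hmax q (Finset.mem_sdiff.2 ⟨hq, hqT.2⟩)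
      · exact h p hp q hq hqT.2

lemma unif_real {α : Type*} [MeasurableSpace α] [MeasurableSingletonClass α] (P : Finset α)
    (hne : P.Nonempty) (T : Finset α) (hT : T ⊆ P) :
    (PMF.uniformOfFinset P hne).toMeasure.real (T : Set α) = T.card / P.card := by
  classical
  rw [Measure.real, PMF.toMeasure_uniformOfFinset_apply hne _ T.measurableSet]
  have : P.filter (fun x => x ∈ (T : Set α)) = T := by
    ext x; simp; exact fun h => hT h
  have h2 := congrArg Finset.card this
  simp [Finset.filter_mem_eq_inter, Finset.inter_eq_right.2 hT]

/-- Generalized Sandwich Lemma in the MEX-with-outliers framework: the sample-based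
size estimate `l̃` of the shape excluding the `t` farthest points (w.r.t. the ranking
function `f`) satisfies `l̃ ≤ l` and `|P ∖ x_{l̃}| ≤ ((1+δ)²/(1-δ))·γ·n`, with
probability at least `1-η`. -/
theorem generalized_sandwich_lemma :
    ∃ c : ℝ, 0 < c ∧
      ∀ (d n : ℕ) (P : Finset (EuclideanSpace ℝ (Fin d))) (hne : P.Nonempty),
        P.card = n →
        ∀ γ δ η : ℝ, γ ∈ Set.Ioo (0 : ℝ) 1 → δ ∈ Set.Ioo (0 : ℝ) (1 / 3) →
          η ∈ Set.Ioo (0 : ℝ) 1 →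
        ∀ f : EuclideanSpace ℝ (Fin d) → ℝ, Set.InjOn f (P : Set _) →
        ∀ x : ℝ → Set (EuclideanSpace ℝ (Fin d)),
          (∀ r r' : ℝ, 0 ≤ r → r ≤ r' → x r ⊆ x r') →
          (∀ r : ℝ, 0 ≤ r → ∀ p₀ ∈ x r, ∀ p : EuclideanSpace ℝ (Fin d),
            f p ≤ f p₀ → p ∈ x r) →
          (∀ p : EuclideanSpace ℝ (Fin d), ∃ rp : ℝ, 0 ≤ rp ∧ p ∈ x rp ∧
            ∀ r : ℝ, 0 ≤ r → r < rp → p ∉ x r) →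
        ∀ t : ℕ, (t : ℝ) = (1 + δ) * γ * n → t < n →
        ∀ t₂ : ℕ, (t₂ : ℝ) = ((1 + δ) ^ 2 / (1 - δ)) * γ * n → t₂ ≤ n →
        ∀ Q : Finset (EuclideanSpace ℝ (Fin d)), Q ⊆ P → Q.card = t →
          (∀ p ∈ Q, ∀ q ∈ P, q ∉ Q → f q < f p) →
        ∀ l : ℝ, 0 ≤ l → (P : Set (EuclideanSpace ℝ (Fin d))) \ x l = (Q : Set _) →
        ∀ m : ℕ, c * (1 / (δ ^ 2 * γ)) * Real.log (1 / η) ≤ (m : ℝ) →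
        ∀ k : ℕ, (k : ℝ) = (1 + δ) ^ 2 * γ * m → k < m →
        ∀ q : (Fin m → EuclideanSpace ℝ (Fin d)) → EuclideanSpace ℝ (Fin d),
          (∀ X : Fin m → EuclideanSpace ℝ (Fin d),
            (∃ j : Fin m, X j = q X) ∧
            ({j : Fin m | f (q X) < f (X j)}).ncard ≤ k ∧
            k + 1 ≤ ({j : Fin m | f (q X) ≤ f (X j)}).ncard) →
        ∀ ltil : (Fin m → EuclideanSpace ℝ (Fin d)) → ℝ,
          (∀ X : Fin m → EuclideanSpace ℝ (Fin d),
            0 ≤ ltil X ∧ q X ∈ x (ltil X) ∧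
            ∀ r : ℝ, 0 ≤ r → r < ltil X → q X ∉ x r) →
        ENNReal.ofReal (1 - η) ≤
          Measure.pi (fun _ : Fin m => (PMF.uniformOfFinset P hne).toMeasure)
            {X : Fin m → EuclideanSpace ℝ (Fin d) |
              ltil X ≤ l ∧
              ((((P : Set (EuclideanSpace ℝ (Fin d))) \ x (ltil X)).ncard : ℝ)) ≤
                ((1 + δ) ^ 2 / (1 - δ)) * γ * n} := by
  refine ⟨10000, by norm_num, ?_⟩
  intro d n P hne hn γ δ η hγ hδ hη f hf x hx1 hx2 hx3 t ht htn t₂ ht₂ ht₂n Q hQP hQc hQ l hl hPl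
    m hm k hk hkm q hq ltil hltil
  obtain ⟨hγ0, hγ1⟩ := hγ
  obtain ⟨hδ0, hδ1⟩ := hδ
  obtain ⟨hη0, hη1⟩ := hη
  have h1δ : 0 < 1 - δ := by linarith
  have hm0 : (0:ℝ) < m := by exact_mod_cast (by omega : 0 < m)
  have hn0 : (0:ℝ) < n := by exact_mod_cast (by omega : 0 < n)
  have hk0 : 1 ≤ k := by
    have : (0:ℝ) < k := by rw [hk]; positivity
    have : 0 < k := by exact_mod_cast this
    omega
  obtain ⟨T, hTP, hTc, hT⟩ := exists_top P f t₂ (by omega)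
  set μ := (PMF.uniformOfFinset P hne).toMeasure with hμ
  set π := Measure.pi (fun _ : Fin m => μ) with hπ
  have hQr : μ.real (Q : Set _) = t / n := by rw [hμ, unif_real P hne Q hQP, hQc, hn]
  have hTr : μ.real (T : Set _) = t₂ / n := by rw [hμ, unif_real P hne T hTP, hTc, hn]
  obtain ⟨mQ, cQ⟩ := count_ms m k (Q : Set (EuclideanSpace ℝ (Fin d))) Q.measurableSet
  obtain ⟨mT, cT⟩ := count_ms m k (T : Set (EuclideanSpace ℝ (Fin d))) T.measurableSet
  replace cQ := cQ μ _ hQr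
  replace cT := cT μ _ hTr
  set EQ := {X : Fin m → EuclideanSpace ℝ (Fin d) | k < ({j : Fin m | X j ∈ (Q : Set _)}).ncard}
  set ET := {X : Fin m → EuclideanSpace ℝ (Fin d) | k < ({j : Fin m | X j ∈ (T : Set _)}).ncard}
  have hwin : 1 - η ≤ π.real ET - π.real EQ := by
    rw [hπ, cT, cQ]
    apply bG_window m k hk0 hkm (δ := δ) _ _ hδ0 hδ1 _ _ hη0
    · have e : 10000 * (1 / (δ ^ 2 * γ)) * Real.log (1 / η)
          = 10000 * Real.log (1 / η) / (δ ^ 2 * γ) := by ring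
      rw [e, div_le_iff₀ (by positivity)] at hm
      refine hm.trans ?_
      rw [hk]
      have : 0 ≤ δ ^ 2 * (γ * m) := by positivity
      nlinarith
    · positivity
    · rw [div_le_one hn0]; exact_mod_cast ht₂n
    · rw [ht, hk]; field_simp
    · rw [ht₂, hk]; field_simp
  have hP : ∀ᵐ X ∂π, ∀ j, X j ∈ P := by
    rw [ae_all_iff]
    intro j
    have h0 : ∀ᵐ y ∂μ, y ∈ P := by
      rw [ae_iff]
      have h1 : μ.real (P : Set _)ᶜ = 0 := by
        rw [probReal_compl_eq_one_sub P.measurableSet, hμ, unif_real P hne P subset_rfl, hn,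
          div_self hn0.ne', sub_self]
      rwa [measureReal_eq_zero_iff] at h1
    exact (Measure.quasiMeasurePreserving_eval (fun _ : Fin m => μ) j).ae h0
  have hdiff : ENNReal.ofReal (1 - η) ≤ π (ET \ EQ) := by
    refine le_trans ?_ le_measure_sdiff
    refine (ENNReal.ofReal_le_ofReal hwin).trans ?_
    rw [ENNReal.ofReal_sub _ measureReal_nonneg]
    simp [measureReal_def]
  refine hdiff.trans ?_
  apply measure_mono_ae
  filter_upwards [hP] with X hXP
  rintro ⟨hXT, hXQ⟩
  obtain ⟨-, hq1, hq2⟩ := hq X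
  obtain ⟨hl0, hlq, hlmin⟩ := hltil X
  change k < _ at hXT
  change ¬ (k < _) at hXQ
  have key1 : ∃ j, f (q X) ≤ f (X j) ∧ X j ∉ Q := by
    by_contra hcon
    push Not at hcon
    have := Set.ncard_le_ncard (s := {j : Fin m | f (q X) ≤ f (X j)})
      (t := {j : Fin m | X j ∈ (Q : Set (EuclideanSpace ℝ (Fin d)))}) (fun j hj => hcon j hj) (Set.toFinite _)
    omega
  have key2 : ∃ j, X j ∈ T ∧ f (X j) ≤ f (q X) := by
    by_contra hcon
    push Not at hcon
    have := Set.ncard_le_ncard (s := {j : Fin m | X j ∈ (T : Set (EuclideanSpace ℝ (Fin d)))})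
      (t := {j : Fin m | f (q X) < f (X j)}) (fun j hj => hcon j hj) (Set.toFinite _)
    omega
  refine ⟨?_, ?_⟩
  · obtain ⟨j, hj1, hj2⟩ := key1
    by_contra hcon
    push Not at hcon
    apply hlmin l hl hcon
    refine hx2 l hl (X j) ?_ _ hj1
    by_contra hxl
    have : X j ∈ (Q : Set _) := by rw [← hPl]; exact ⟨hXP j, hxl⟩
    exact hj2 this
  · obtain ⟨j, hj1, hj2⟩ := key2
    rw [← ht₂, ← hTc, Nat.cast_le, ← Set.ncard_coe_finset T]
    apply Set.ncard_le_ncard _ (Finset.finite_toSet T)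
    rintro p ⟨hpP, hpx⟩
    by_contra hpT
    exact hpx (hx2 _ hl0 _ hlq p ((hT _ hj1 p hpP hpT).trans hj2))
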